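/- (Lemma 1(v)) If f is a blocking flow in a rooted tree instance I(e), then for every terminal t ∈ T_e and every odd set W ∈ odd(V_f(t)), the parent-edge e_W of W satisfies c(e_W) − 1 ∈ Ψ(e_W). -/

import Mathlib

open Classical

/-- `⟨a,b⟩`: the set `{a, a+2, …, b}` of consecutive odd or even integers. -/
def Iv (a b : ℕ) : Set ℕ := {x | a ≤ x ∧ x ≤ b ∧ x % 2 = a % 2}

/-- `A ⊗ B = {a + b − 2i : a ∈ A, b ∈ B, 0 ≤ i ≤ min(a,b)}`. -/
def otimes (A B : Set ℕ) : Set ℕ :=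
  {x | ∃ a ∈ A, ∃ b ∈ B, ∃ i, i ≤ min a b ∧ x = a + b - 2 * i}

/-- A tree instance `(G,T,c)` rooted at a terminal `r`: a tree on vertex set `V`,
encoded by the parent function `par` (with `par root = root`) together with a depth
function certifying acyclicity.  Each non-root vertex `v` is identified with the edge
`(par v, v)`; `c v` is the (positive integer) capacity of that edge.  The terminals are
the leaves; the root has exactly one child and every internal vertex has exactly
two children (total degree 3). -/
structure RTI (V : Type*) where
  root : V
  par : V → V
  dep : V → ℕ
  c : V → ℕ
  par_root : par root = root
  dep_root : dep root = 0
  dep_par : ∀ v, v ≠ root → dep v = dep (par v) + 1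
  cap_pos : ∀ v, v ≠ root → 1 ≤ c v
  root_degree : {w : V | par w = root ∧ w ≠ root}.ncard = 1
  internal_degree : ∀ v, v ≠ root → {w : V | par w = v ∧ w ≠ root}.Nonempty →
    {w : V | par w = v ∧ w ≠ root}.ncard = 2

namespace RTI

variable {V : Type*} (R : RTI V)

/-- `R.below u v`: `v` lies in the subtree rooted at `u` (i.e. `u` is an ancestor of
`v`, allowing `u = v`). -/
def below (u v : V) : Prop :=
  Relation.ReflTransGen (fun a b => R.par b = a ∧ b ≠ R.root) u v

/-- `v` is a leaf of the tree other than the root. -/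
def leaf (v : V) : Prop := v ≠ R.root ∧ ∀ w, w ≠ R.root → R.par w ≠ v

/-- The children of `v` (as lower endpoints of child-edges). -/
def children (v : V) : Set V := {w | R.par w = v ∧ w ≠ R.root}

/-- For an edge `e = (par v, v)`, the vertex set `V_e` of the instance `I(e)`. -/
def Ve (v : V) : Set V := insert (R.par v) {w | R.below v w}

/-- `T_e`: the terminals of `I(e)` other than `u = par v`. -/
def Te (v : V) : Set V := {w | R.below v w ∧ R.leaf w}

/-- The full terminal set `T_e ∪ {u}` of the instance `I(e)`. -/
def S (v : V) : Set V := insert (R.par v) (R.Te v)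

/-- The edge `(par x, x)` lies on the tree path between `t` and `t'`
(exactly one of `t, t'` is in the subtree below `x`). -/
def onPath (x t t' : V) : Prop :=
  (R.below x t ∧ ¬ R.below x t') ∨ (¬ R.below x t ∧ R.below x t')

/-- The vertex `x` lies on the tree path between `t` and `t'`. -/
def onPathV (x t t' : V) : Prop :=
  (R.below x t ∨ R.below x t') ∧ ∀ z, R.below z t → R.below z t' → R.below z x

/-- Unordered pairs of distinct terminals of the instance `I(e)` for `e = (par v, v)`. -/
def PathPairs (v : V) : Set (Sym2 V) :=
  {p | ∃ t t', t ∈ R.S v ∧ t' ∈ R.S v ∧ t ≠ t' ∧ p = s(t, t')}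

/-- `g` is a decomposition of `f` in the instance `I(e)`, `e = (par v, v)`:
`g` is supported on pairs of distinct terminals and, on every edge of `I(e)`,
`f` is the sum of `g` over the (unique) terminal-pair paths through that edge. -/
def IsDecomp (v : V) (f : V → ℕ) (g : Sym2 V → ℕ) : Prop :=
  (∀ p, g p ≠ 0 → p ∈ R.PathPairs v) ∧
  ∀ w, R.below v w →
    f w = ∑ᶠ p ∈ {p : Sym2 V | ∃ t t', p = s(t, t') ∧ R.onPath w t t'}, g p

/-- `f` is an (integral) flow in the instance `I(e)`, `e = (par v, v)`. -/
def IsFlow (v : V) (f : V → ℕ) : Prop := ∃ g, R.IsDecomp v f g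

/-- `f` is feasible in `I(e)`. -/
def Feasible (v : V) (f : V → ℕ) : Prop := ∀ w, R.below v w → f w ≤ R.c w

/-- `V_f(s)`: the set of vertices `w` of `I(e)` reachable from `s` by travelling
upward along edges with `c − f ≥ 1` to a common ancestor and then downward along
edges with `c − f ≥ 2`. -/
def Vf (v : V) (f : V → ℕ) (s : V) : Set V :=
  {w | w ∈ R.Ve v ∧ ∃ z ∈ R.Ve v, R.below z s ∧ R.below z w ∧
    (∀ x, R.below z x → R.below x s → x ≠ z → f x + 1 ≤ R.c x) ∧
    (∀ x, R.below z x → R.below x w → x ≠ z → f x + 2 ≤ R.c x)}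

/-- `W` induces a connected subgraph of the tree (it is closed under tree paths). -/
def ConnSet (W : Set V) : Prop :=
  ∀ w₁ ∈ W, ∀ w₂ ∈ W, ∀ x, R.onPathV x w₁ w₂ → x ∈ W

/-- `E(X)` inside the instance `I(e)`, `e = (par v, v)`: the edges `(par x, x)` of
`I(e)` with exactly one endpoint in `X`. -/
def cutE (v : V) (X : Set V) : Set V :=
  {x | R.below v x ∧ ¬ (x ∈ X ↔ R.par x ∈ X)}

/-- `h(X) = Σ_{e' ∈ E(X)} h(e')` inside the instance `I(e)`, `e = (par v, v)`. -/
noncomputable def hval (v : V) (X : Set V) (h : V → ℕ) : ℕ := ∑ᶠ x ∈ R.cutE v X, h x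

/-- `W` is a connected component of the subgraph of `I(e)` induced by `A`. -/
def IsComp (v : V) (A W : Set V) : Prop :=
  W.Nonempty ∧ W ⊆ A ∧ R.ConnSet W ∧
  (∀ x, R.below v x → x ∈ W → R.par x ∈ A → R.par x ∈ W) ∧
  (∀ x, R.below v x → R.par x ∈ W → x ∈ A → x ∈ W)

/-- `odd(X)` (relative to the union `U` of the removed terminal sets): the components
`W` of `G_e − U` with `c(W)` odd whose parent-edge is a child-edge of `X`. -/
def oddOf (v : V) (U X : Set V) : Set (Set V) :=
  {W | R.IsComp v (R.Ve v \ U) W ∧ Odd (R.hval v W R.c) ∧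
    ∃ y ∈ W, R.par y ∉ W ∧ R.par y ∈ X}

/-- The union of the sets `V_f(t)`, `t ∈ T_e`. -/
def UT (v : V) (f : V → ℕ) : Set V := ⋃ t ∈ R.Te v, R.Vf v f t

/-- The union of the sets `V_f(t)`, `t ∈ T_e ∪ {u}`. -/
def USall (v : V) (f : V → ℕ) : Set V := ⋃ t ∈ R.S v, R.Vf v f t

/-- `f` is a blocking flow in `I(e)`, `e = (par v, v)`: a feasible flow such that
`{V_f(t) : t ∈ T_e}` is a cut-system of `T_e` (pairwise disjoint `t`-sets avoiding the
terminal `u = par v`) each member of which is blocked by `f`, i.e.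
`f(e_t) = f(V_f(t)) = c(V_f(t)) − |odd(V_f(t))|`. -/
def IsBlocking (v : V) (f : V → ℕ) : Prop :=
  R.IsFlow v f ∧ R.Feasible v f ∧
  (∀ t ∈ R.Te v, R.par v ∉ R.Vf v f t) ∧
  (∀ t ∈ R.Te v, ∀ t' ∈ R.Te v, t ≠ t' → R.Vf v f t ∩ R.Vf v f t' = ∅) ∧
  (∀ t ∈ R.Te v, f t = R.hval v (R.Vf v f t) f ∧
    R.hval v (R.Vf v f t) f + (R.oddOf v (R.UT v f) (R.Vf v f t)).ncard
      = R.hval v (R.Vf v f t) R.c)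

/-- `Ψ(e)`: the set of values `f(e)` of blocking flows `f` of `I(e)`, `e = (par v, v)`. -/
def Psi (v : V) : Set ℕ := {x | ∃ f, R.IsBlocking v f ∧ f v = x}

/-- `a(e)`: the least element of `Ψ(e)`. -/
noncomputable def aE (v : V) : ℕ := sInf (R.Psi v)

/-- `b(e)`: the greatest element of `Ψ(e)`. -/
noncomputable def bE (v : V) : ℕ := sSup (R.Psi v)

/-- The edge `(par x, x)` is dominating: `b(e') + 2 ≤ a(e)` for its sibling edge `e'`. -/
def Dominating (x : V) : Prop :=
  x ≠ R.root ∧ ∃ y, y ≠ R.root ∧ y ≠ x ∧ R.par y = R.par x ∧ R.bE y + 2 ≤ R.aE x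

/-- The path from `v` down to `t` consists of dominating edges. -/
def DomPath (v t : V) : Prop :=
  R.below v t ∧ ∀ x, R.below v x → R.below x t → x ≠ v → R.Dominating x

/-- Condition (a) for the edge `e = (par v, v)`. -/
def CondA (v : V) : Prop :=
  (∃ a b, R.Psi v = Iv a b) ∧
  (R.leaf v → R.Psi v = {R.c v}) ∧
  (∀ w₁ w₂, w₁ ≠ w₂ → R.children v = {w₁, w₂} →
    R.Psi v = (otimes (R.Psi w₁) (R.Psi w₂) ∩ Set.Iic (R.c v)) ∪ {R.c v})

/-- Condition (b) for the edge `e = (u,v)`: if `e` has a dominating child-edge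
`e' = (v,w)`, then there is a terminal `t ∈ T_{e'}` with `g(u,t) ≥ a(e)` for every
decomposition `g` of every blocking flow of `I(e)`, and `P_{v,t}` a dominating path. -/
def CondB (v : V) : Prop :=
  ∀ w ∈ R.children v, R.Dominating w →
    ∃ t ∈ R.Te w, R.DomPath v t ∧
      ∀ f g, R.IsBlocking v f → R.IsDecomp v f g → R.aE v ≤ g s(R.par v, t)

/-- `γ(𝒳)` for the cut-system `𝒳 = {V_f(t) : t ∈ T_e ∪ {u}}`. -/
noncomputable def gammaX (v : V) (f : V → ℕ) : ℕ :=
  ∑ᶠ t ∈ R.S v, R.hval v (R.Vf v f t) R.c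

/-- `κ(𝒳)` for the cut-system `𝒳 = {V_f(t) : t ∈ T_e ∪ {u}}`: the number of
components of `G_e − ∪𝒳` of odd capacity. -/
noncomputable def kappaX (v : V) (f : V → ℕ) : ℕ :=
  {W : Set V | R.IsComp v (R.Ve v \ R.USall v f) W ∧ Odd (R.hval v W R.c)}.ncard

end RTI

namespace RTI

variable {V : Type*} {R : RTI V}

theorem below_refl (x : V) : R.below x x := Relation.ReflTransGen.refl

theorem below.trans {x y z : V} (h : R.below x y) (h' : R.below y z) : R.below x z :=
  Relation.ReflTransGen.trans h h'

theorem below_par {x : V} (hx : x ≠ R.root) : R.below (R.par x) x :=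
  Relation.ReflTransGen.single ⟨rfl, hx⟩

theorem below.cases_par {z x : V} (h : R.below z x) :
    z = x ∨ (x ≠ R.root ∧ R.below z (R.par x)) := by
  rcases Relation.ReflTransGen.cases_tail h with h | ⟨b, hb, rfl, hx⟩
  · exact Or.inl h.symm
  · exact Or.inr ⟨hx, hb⟩

theorem below.eq_or_dep_lt {z x : V} (h : R.below z x) : z = x ∨ R.dep z < R.dep x := by
  induction h with
  | refl => exact Or.inl rfl
  | tail _ hbc ih =>
    obtain ⟨rfl, hc⟩ := hbc
    have := R.dep_par _ hc
    rcases ih with rfl | ih <;> right <;> omega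

theorem below.dep_le {z x : V} (h : R.below z x) : R.dep z ≤ R.dep x := by
  rcases h.eq_or_dep_lt with rfl | h <;> omega

theorem below.antisymm {z x : V} (h : R.below z x) (h' : R.below x z) : z = x := by
  rcases h.eq_or_dep_lt with h | h
  · exact h
  · have := h'.dep_le
    omega

theorem below.total {a b w : V} (ha : R.below a w) (hb : R.below b w) :
    R.below a b ∨ R.below b a := by
  induction ha with
  | refl => exact Or.inr hb
  | tail h hbc ih =>
    obtain ⟨rfl, hc⟩ := hbc
    rcases hb.cases_par with rfl | ⟨_, hb⟩
    · exact Or.inl (h.tail ⟨rfl, hc⟩)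
    · exact ih hb

theorem below.ne_root {v x : V} (hv : v ≠ R.root) (h : R.below v x) : x ≠ R.root := by
  rcases h.cases_par with rfl | ⟨h, _⟩ <;> assumption

theorem not_below_par {x : V} (hx : x ≠ R.root) : ¬ R.below x (R.par x) := fun h => by
  have := h.dep_le
  have := R.dep_par x hx
  omega

theorem par_mem_Ve {v x : V} (h : R.below v x) : R.par x ∈ R.Ve v := by
  rcases h.cases_par with rfl | ⟨_, h⟩
  · exact Set.mem_insert _ _
  · exact Or.inr h

theorem Ve_subset {v y : V} (h : R.below v y) : R.Ve y ⊆ R.Ve v := by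
  rintro w (rfl | hw)
  · exact par_mem_Ve h
  · exact Or.inr (h.trans hw)

section Reachable

variable {v y s : V} {f : V → ℕ}

theorem self_mem_Vf (h : R.below v s) : s ∈ R.Vf v f s :=
  ⟨Or.inr h, s, Or.inr h, below_refl _, below_refl _,
    fun _ h₁ h₂ h₃ => (h₃ (h₂.antisymm h₁)).elim, fun _ h₁ h₂ h₃ => (h₃ (h₂.antisymm h₁)).elim⟩

theorem cap_le_of_mem_Vf_of_par_notMem {x : V} (hv : v ≠ R.root) (hx : R.below v x)
    (h : x ∈ R.Vf v f s) (hp : R.par x ∉ R.Vf v f s) : R.c x ≤ f x := by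
  obtain ⟨-, z, hz, hzs, hzx, hup, hdown⟩ := h
  have hxr := hx.ne_root hv
  by_contra! hlt
  refine hp ⟨par_mem_Ve hx, ?_⟩
  rcases hzx.cases_par with rfl | ⟨_, hzp⟩
  · refine ⟨R.par z, par_mem_Ve hx, (below_par hxr).trans hzs, below_refl _, ?_,
      fun _ h₁ h₂ h₃ => (h₃ (h₂.antisymm h₁)).elim⟩
    intro a h₁ h₂ h₃
    by_cases haz : a = z
    · subst haz
      omega
    rcases h₂.total hzs with h | h
    · rcases h.cases_par with h | ⟨_, h⟩
      · exact (haz h).elim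
      · exact (h₃ (h.antisymm h₁)).elim
    · exact hup a h h₂ haz
  · exact ⟨z, hz, hzs, hzp, hup, fun a h₁ h₂ h₃ => hdown a h₁ (h₂.trans (below_par hxr)) h₃⟩

theorem cap_le_succ_of_par_mem_Vf_of_notMem (hv : v ≠ R.root) (hy : R.below v y)
    (hp : R.par y ∈ R.Vf v f s) (h : y ∉ R.Vf v f s) : R.c y ≤ f y + 1 := by
  obtain ⟨-, z, hz, hzs, hzx, hup, hdown⟩ := hp
  by_contra! hlt
  refine h ⟨Or.inr hy, z, hz, hzs, hzx.trans (below_par (hy.ne_root hv)), hup, ?_⟩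
  intro x h₁ h₂ h₃
  rcases h₂.cases_par with rfl | ⟨_, h₂⟩
  · omega
  · exact hdown x h₁ h₂ h₃

theorem mem_Vf_of_below {w : V} (hy : R.below v y) (hs : ¬ R.below y s)
    (hw : w ∈ R.Vf v f s) (hyw : R.below y w) : y ∈ R.Vf v f s := by
  obtain ⟨-, z, hz, hzs, hzx, hup, hdown⟩ := hw
  rcases hzx.total hyw with h | h
  · exact ⟨Or.inr hy, z, hz, hzs, h, hup, fun x h₁ h₂ h₃ => hdown x h₁ (h₂.trans hyw) h₃⟩
  · exact (hs (h.trans hzs)).elim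

theorem apex_below_of_notMem_Vf {z : V} (hy : R.below v y) (hs : R.below y s)
    (h : y ∉ R.Vf v f s) (hzs : R.below z s)
    (hup : ∀ x, R.below z x → R.below x s → x ≠ z → f x + 1 ≤ R.c x) : R.below y z := by
  rcases hzs.total hs with hzy | hyz
  · refine (h ⟨Or.inr hy, y, Or.inr hy, hs, below_refl _, fun x h₁ h₂ h₃ => ?_,
      fun _ h₁ h₂ h₃ => (h₃ (h₂.antisymm h₁)).elim⟩).elim
    refine hup x (hzy.trans h₁) h₂ ?_
    rintro rfl
    exact h₃ (hzy.antisymm h₁)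
  · exact hyz

theorem below_of_mem_Vf {w : V} (hy : R.below v y) (hs : R.below y s)
    (h : y ∉ R.Vf v f s) (hw : w ∈ R.Vf v f s) : R.below y w := by
  obtain ⟨-, z, hz, hzs, hzx, hup, hdown⟩ := hw
  exact (apex_below_of_notMem_Vf hy hs h hzs hup).trans hzx

theorem Vf_eq_of_notMem (hy : R.below v y) (hs : R.below y s)
    (h : y ∉ R.Vf v f s) : R.Vf y f s = R.Vf v f s := by
  ext w
  constructor
  · rintro ⟨hw, z, hz, h⟩
    exact ⟨Ve_subset hy hw, z, Ve_subset hy hz, h⟩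
  · intro hw
    have hyw := below_of_mem_Vf hy hs h hw
    obtain ⟨-, z, -, hzs, hzx, hup, hdown⟩ := hw
    exact ⟨Or.inr hyw, z, Or.inr (apex_below_of_notMem_Vf hy hs h hzs hup),
      hzs, hzx, hup, hdown⟩

end Reachable

theorem ConnSet.below_top {W : Set V} {y w : V} (hW : R.ConnSet W) (hy : y ∈ W)
    (hp : R.par y ∉ W) (hw : w ∈ W) : R.below y w := by
  by_contra h
  have hyr : y ≠ R.root := by
    rintro rfl
    exact hp (R.par_root.symm ▸ hy)
  refine hp (hW y hy w hw _ ⟨Or.inl (below_par hyr), fun z hz hzw => ?_⟩)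
  rcases hz.cases_par with rfl | ⟨_, hz⟩
  · exact (h hzw).elim
  · exact hz

theorem cutE_eq {v y : V} {X : Set V} (hv : v ≠ R.root) (hy : R.below v y)
    (hX : ∀ x ∈ X, R.below y x) : R.cutE y X = R.cutE v X := by
  ext x
  refine ⟨fun h => ⟨hy.trans h.1, h.2⟩, fun h => ⟨?_, h.2⟩⟩
  by_cases hx : x ∈ X
  · exact hX x hx
  · have hpx : R.par x ∈ X := by
      by_contra hpx
      exact h.2 (by simp [hx, hpx])
    exact (hX _ hpx).trans (below_par (h.1.ne_root hv))

theorem isComp_iff {v y : V} {A A' W : Set V} (hy : R.below v y)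
    (hA : ∀ w, R.below y w → (w ∈ A' ↔ w ∈ A)) (hv : v ≠ R.root)
    (hW : ∀ x ∈ W, R.below y x) (hyW : y ∉ W) : R.IsComp y A' W ↔ R.IsComp v A W := by
  have hpar : ∀ x ∈ W, R.below y (R.par x) := by
    intro x hx
    rcases (hW x hx).cases_par with rfl | h
    · exact (hyW hx).elim
    · exact h.2
  have hchild : ∀ x, R.below v x → R.par x ∈ W → R.below y x := fun x hvx hx =>
    (hW _ hx).trans (below_par (hvx.ne_root hv))
  unfold IsComp
  refine and_congr_right fun _ => and_congr ?_ (and_congr_right fun _ => and_congr ?_ ?_)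
  · exact ⟨fun h x hx => (hA x (hW x hx)).1 (h hx), fun h x hx => (hA x (hW x hx)).2 (h hx)⟩
  · exact ⟨fun h x _ hx hp => h x (hW x hx) hx ((hA _ (hpar x hx)).2 hp),
      fun h x hyx hx hp => h x (hy.trans hyx) hx ((hA _ (hpar x hx)).1 hp)⟩
  · exact ⟨fun h x hvx hp hx => h x (hchild x hvx hp) hp ((hA _ (hchild x hvx hp)).2 hx),
      fun h x hyx hp hx => h x (hy.trans hyx) hp ((hA _ hyx).1 hx)⟩

theorem oddOf_eq {v y : V} {U U' X : Set V} (hv : v ≠ R.root) (hy : R.below v y)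
    (hU : ∀ w, R.below y w → (w ∈ U' ↔ w ∈ U)) (hX : ∀ x ∈ X, R.below y x) :
    R.oddOf y U' X = R.oddOf v U X := by
  have hA : ∀ w, R.below y w → (w ∈ R.Ve y \ U' ↔ w ∈ R.Ve v \ U) := fun w hw =>
    ⟨fun h => ⟨Ve_subset hy h.1, fun h' => h.2 ((hU w hw).2 h')⟩,
      fun h => ⟨Or.inr hw, fun h' => h.2 ((hU w hw).1 h')⟩⟩
  have key : ∀ W, R.ConnSet W → (∃ a ∈ W, R.par a ∉ W ∧ R.par a ∈ X) →
      (∀ x ∈ W, R.below y x) ∧ y ∉ W := by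
    rintro W hW ⟨a, ha, hpa, hpX⟩
    have har : a ≠ R.root := by
      rintro rfl
      exact hpa (R.par_root.symm ▸ ha)
    have hya := (hX _ hpX).trans (below_par har)
    refine ⟨fun x hx => hya.trans (hW.below_top ha hpa hx), fun hyW => ?_⟩
    exact not_below_par har ((hW.below_top ha hpa hyW).trans (hX _ hpX))
  ext W
  constructor
  · rintro ⟨hc, ho, he⟩
    obtain ⟨h₁, h₂⟩ := key W hc.2.2.1 he
    refine ⟨(isComp_iff hy hA hv h₁ h₂).1 hc, ?_, he⟩
    rwa [hval, cutE_eq hv hy h₁] at ho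
  · rintro ⟨hc, ho, he⟩
    obtain ⟨h₁, h₂⟩ := key W hc.2.2.1 he
    refine ⟨(isComp_iff hy hA hv h₁ h₂).2 hc, ?_, he⟩
    rwa [hval, cutE_eq hv hy h₁]

theorem onPath_comm {x t t' : V} : R.onPath x t t' ↔ R.onPath x t' t := by
  unfold onPath
  tauto

/-- The unordered pairs whose tree path uses the edge `(par x, x)`. -/
def pathsThrough (R : RTI V) (x : V) : Set (Sym2 V) :=
  {p | ∃ t t', p = s(t, t') ∧ R.onPath x t t'}

theorem mk_mem_pathsThrough {x t t' : V} : s(t, t') ∈ R.pathsThrough x ↔ R.onPath x t t' := by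
  constructor
  · rintro ⟨a, b, hab, h⟩
    rcases Sym2.eq_iff.1 hab with ⟨rfl, rfl⟩ | ⟨rfl, rfl⟩
    · exact h
    · exact onPath_comm.1 h
  · exact fun h => ⟨t, t', rfl, h⟩

theorem finsum_mem_eq_sum_ite {α : Type*} [Fintype α] (s : Set α) (h : α → ℕ) :
    ∑ᶠ a ∈ s, h a = ∑ a, if a ∈ s then h a else 0 := by
  rw [finsum_mem_def, finsum_eq_sum_of_fintype]
  rfl

theorem IsFlow.restrict [Fintype V] {v y : V} {f : V → ℕ} (hv : v ≠ R.root)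
    (hy : R.below v y) (hf : R.IsFlow v f) : R.IsFlow y f := by
  obtain ⟨g, hg, hfg⟩ := hf
  have hyr := hy.ne_root hv
  let π : V → V := fun t => if R.below y t then t else R.par y
  have hπ : ∀ x, R.below y x → ∀ t, R.below x (π t) ↔ R.below x t := by
    intro x hx t
    by_cases ht : R.below y t
    · simp [π, ht]
    · simp only [π, ht, if_false]
      exact ⟨fun h => (not_below_par hyr (hx.trans h)).elim, fun h => (ht (hx.trans h)).elim⟩
  have hmap : ∀ x, R.below y x → ∀ q : Sym2 V,
      q.map π ∈ R.pathsThrough x ↔ q ∈ R.pathsThrough x := by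
    intro x hx q
    induction q with
    | _ t t' =>
      rw [Sym2.map_mk, mk_mem_pathsThrough, mk_mem_pathsThrough, onPath, onPath]
      simp only [hπ x hx]
  have hS : ∀ t ∈ R.S v, π t ∈ R.S y := by
    intro t ht
    by_cases hyt : R.below y t
    · simp only [π, hyt, if_true]
      rcases ht with rfl | ht
      · exact (not_below_par hv (hy.trans hyt)).elim
      · exact Or.inr ⟨hyt, ht.2⟩
    · simp only [π, hyt, if_false]
      exact Or.inl rfl
  have hpairs : ∀ x, R.below y x → ∀ q ∈ R.PathPairs v, q ∈ R.pathsThrough x →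
      q.map π ∈ R.PathPairs y := by
    rintro x hx q ⟨t, t', ht, ht', -, rfl⟩ hq
    refine ⟨π t, π t', hS t ht, hS t' ht', fun h => ?_, Sym2.map_mk _ _ _⟩
    rw [mk_mem_pathsThrough, onPath, ← hπ x hx t, ← hπ x hx t', h] at hq
    tauto
  refine ⟨fun p => if p ∈ R.PathPairs y then ∑ q : Sym2 V, if q.map π = p then g q else 0 else 0,
    fun p hp => ?_, fun x hx => ?_⟩
  · by_contra h
    simp [h] at hp
  · rw [hfg x (hy.trans hx)]
    change ∑ᶠ p ∈ R.pathsThrough x, _ = ∑ᶠ p ∈ R.pathsThrough x, _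
    rw [finsum_mem_eq_sum_ite, finsum_mem_eq_sum_ite]
    have hswap : ∀ p : Sym2 V, (if p ∈ R.pathsThrough x then
        (if p ∈ R.PathPairs y then ∑ q : Sym2 V, if q.map π = p then g q else 0 else 0) else 0) =
        ∑ q : Sym2 V, if q.map π = p then
          (if p ∈ R.pathsThrough x ∧ p ∈ R.PathPairs y then g q else 0) else 0 := by
      intro p
      by_cases h₁ : p ∈ R.pathsThrough x <;> by_cases h₂ : p ∈ R.PathPairs y <;> simp [h₁, h₂]
    simp_rw [hswap]
    rw [Finset.sum_comm]
    refine Finset.sum_congr rfl fun q _ => ?_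
    rw [Finset.sum_ite_eq]
    simp only [Finset.mem_univ, if_true, hmap x hx]
    by_cases hq : q ∈ R.pathsThrough x
    · by_cases hgq : g q = 0
      · simp [hgq]
      · simp [hq, hpairs x hx q (hg q hgq) hq]
    · simp [hq]

theorem sum_cutE_below [Fintype V] {v : V} (hv : v ≠ R.root) {W : Set V} (hvW : R.par v ∉ W)
    {t : V} (ht : R.below v t) :
    ∑ x, (if x ∈ R.cutE v W ∧ R.below x t then (1 : ZMod 2) else 0) = if t ∈ W then 1 else 0 := by
  induction ht with
  | refl =>
    have : ∀ x, (x ∈ R.cutE v W ∧ R.below x v) ↔ (x = v ∧ v ∈ W) := by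
      intro x
      constructor
      · rintro ⟨h₁, h₂⟩
        obtain rfl := h₂.antisymm h₁.1
        refine ⟨rfl, ?_⟩
        by_contra h
        exact h₁.2 (by simp [h, hvW])
      · rintro ⟨rfl, h⟩
        exact ⟨⟨below_refl _, by simp [h, hvW]⟩, below_refl _⟩
    simp [this, ite_and]
  | @tail a b hab hb ih =>
    obtain ⟨rfl, hbr⟩ := hb
    have hvb : R.below v b := hab.tail ⟨rfl, hbr⟩
    have : ∀ x, (if x ∈ R.cutE v W ∧ R.below x b then (1 : ZMod 2) else 0) =
        (if x ∈ R.cutE v W ∧ R.below x (R.par b) then 1 else 0) +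
          if x = b then (if b ∈ R.cutE v W then 1 else 0) else 0 := by
      intro x
      by_cases hx : x = b
      · subst hx
        simp [below_refl, not_below_par hbr]
      · have : R.below x b ↔ R.below x (R.par b) := by
          refine ⟨fun h => ?_, fun h => h.trans (below_par hbr)⟩
          rcases h.cases_par with h | h
          · exact (hx h).elim
          · exact h.2
        simp [hx, this]
    simp_rw [this, Finset.sum_add_distrib, ih, Finset.sum_ite_eq']
    have hcut : b ∈ R.cutE v W ↔ ¬ (b ∈ W ↔ R.par b ∈ W) := ⟨fun h => h.2, fun h => ⟨hvb, h⟩⟩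
    by_cases h₁ : b ∈ W <;> by_cases h₂ : R.par b ∈ W <;> simp [hcut, h₁, h₂]
    decide

theorem IsFlow.even_hval [Fintype V] {v : V} {f : V → ℕ} (hv : v ≠ R.root)
    (hf : R.IsFlow v f) {W : Set V} (hW : ∀ t ∈ R.S v, t ∉ W) : Even (R.hval v W f) := by
  obtain ⟨g, hg, hfg⟩ := hf
  have hvW : R.par v ∉ W := hW _ (Or.inl rfl)
  have hzero : ∀ t ∈ R.S v,
      ∑ x, (if x ∈ R.cutE v W ∧ R.below x t then (1 : ZMod 2) else 0) = 0 := by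
    rintro t (rfl | ht)
    · refine Finset.sum_eq_zero fun x _ => if_neg ?_
      rintro ⟨h₁, h₂⟩
      exact not_below_par hv (h₁.1.trans h₂)
    · rw [sum_cutE_below hv hvW ht.1, if_neg (hW t (Or.inr ht))]
  have hcross : ∀ p ∈ R.PathPairs v,
      ∑ x, (if x ∈ R.cutE v W ∧ p ∈ R.pathsThrough x then (1 : ZMod 2) else 0) = 0 := by
    rintro p ⟨t, t', ht, ht', -, rfl⟩
    have : ∀ x, (if x ∈ R.cutE v W ∧ s(t, t') ∈ R.pathsThrough x then (1 : ZMod 2) else 0) =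
        (if x ∈ R.cutE v W ∧ R.below x t then 1 else 0) +
          if x ∈ R.cutE v W ∧ R.below x t' then 1 else 0 := by
      intro x
      rw [mk_mem_pathsThrough, onPath]
      by_cases h₀ : x ∈ R.cutE v W <;> by_cases h₁ : R.below x t <;>
        by_cases h₂ : R.below x t' <;> simp [h₀, h₁, h₂]
      decide
    simp_rw [this, Finset.sum_add_distrib, hzero t ht, hzero t' ht', add_zero]
  rw [← ZMod.natCast_eq_zero_iff_even, hval, finsum_mem_eq_sum_ite]
  have hterm : ∀ x, ((if x ∈ R.cutE v W then f x else 0 : ℕ) : ZMod 2) =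
      ∑ p : Sym2 V, (g p : ZMod 2) *
        if x ∈ R.cutE v W ∧ p ∈ R.pathsThrough x then 1 else 0 := by
    intro x
    by_cases hx : x ∈ R.cutE v W
    · rw [if_pos hx, hfg x hx.1]
      change ((∑ᶠ p ∈ R.pathsThrough x, g p : ℕ) : ZMod 2) = _
      rw [finsum_mem_eq_sum_ite]
      simp [hx]
    · simp [hx]
  rw [Nat.cast_sum]
  simp_rw [hterm]
  rw [Finset.sum_comm]
  refine Finset.sum_eq_zero fun p _ => ?_
  rw [← Finset.mul_sum]
  by_cases hp : g p = 0
  · simp [hp]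
  · rw [hcross p (hg p hp), mul_zero]

theorem IsBlocking.restrict [Fintype V] {v y : V} {f : V → ℕ} (hv : v ≠ R.root)
    (hy : R.below v y) (hf : R.IsBlocking v f) (hyU : y ∉ R.UT v f) : R.IsBlocking y f := by
  obtain ⟨hflow, hfeas, -, hdisj, hblock⟩ := hf
  have hyr := hy.ne_root hv
  have hT : ∀ t ∈ R.Te y, t ∈ R.Te v := fun t ht => ⟨hy.trans ht.1, ht.2⟩
  have hnot : ∀ t ∈ R.Te v, y ∉ R.Vf v f t := fun t ht h =>
    hyU (Set.mem_biUnion ht h)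
  have hVf : ∀ t ∈ R.Te y, R.Vf y f t = R.Vf v f t := fun t ht =>
    Vf_eq_of_notMem hy ht.1 (hnot t (hT t ht))
  have hbel : ∀ t ∈ R.Te y, ∀ x ∈ R.Vf v f t, R.below y x := fun t ht x hx =>
    below_of_mem_Vf hy ht.1 (hnot t (hT t ht)) hx
  have hU : ∀ w, R.below y w → (w ∈ R.UT y f ↔ w ∈ R.UT v f) := by
    intro w hw
    simp only [UT, Set.mem_iUnion]
    constructor
    · rintro ⟨t, ht, h⟩
      exact ⟨t, hT t ht, hVf t ht ▸ h⟩
    · rintro ⟨t, ht, h⟩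
      by_cases hyt : R.below y t
      · exact ⟨t, ⟨hyt, ht.2⟩, (hVf t ⟨hyt, ht.2⟩).symm ▸ h⟩
      · exact (hnot t ht (mem_Vf_of_below hy hyt h hw)).elim
  refine ⟨hflow.restrict hv hy, fun w hw => hfeas w (hy.trans hw), ?_, ?_, ?_⟩
  · intro t ht h
    rw [hVf t ht] at h
    exact not_below_par hyr (hbel t ht _ h)
  · intro t ht t' ht' hne
    rw [hVf t ht, hVf t' ht']
    exact hdisj t (hT t ht) t' (hT t' ht') hne
  · intro t ht
    have h := hblock t (hT t ht)
    rw [hVf t ht, oddOf_eq hv hy hU (hbel t ht)]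
    simp only [hval] at h ⊢
    rwa [cutE_eq hv hy (hbel t ht)]

end RTI

/-- Lemma 1(v): if `f` is a blocking flow in `I(e)`, then for every
terminal `t ∈ T_e` and every odd set `W ∈ odd(V_f(t))`, the parent-edge `e_W` of `W`
satisfies `c(e_W) − 1 ∈ Ψ(e_W)`. -/
theorem RTI.oddSet_parentEdge_mem_Psi {V : Type*} [Fintype V] [DecidableEq V]
    (R : RTI V) (v : V) (hv : v ≠ R.root)
    (f : V → ℕ) (hf : R.IsBlocking v f) :
    ∀ t ∈ R.Te v, ∀ W ∈ R.oddOf v (R.UT v f) (R.Vf v f t),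
      ∀ y ∈ W, R.par y ∉ W → R.c y - 1 ∈ R.Psi y := by
  intro t ht W hW y hyW hpy
  obtain ⟨⟨-, hWA, hconn, -, hdown⟩, hodd, y₀, hy₀, hpy₀, hpX⟩ := hW
  obtain rfl : y₀ = y :=
    (hconn.below_top hy₀ hpy₀ hyW).antisymm (hconn.below_top hyW hpy hy₀)
  have hyr : y₀ ≠ R.root := by
    rintro rfl
    exact hpy (R.par_root.symm ▸ hyW)
  have hvpy : R.below v (R.par y₀) := by
    rcases hpX.1 with h | h
    · exact (hf.2.2.1 t ht (h ▸ hpX)).elim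
    · exact h
  have hvy := hvpy.trans (RTI.below_par hyr)
  have hyU := (hWA hyW).2
  have hUT : ∀ s ∈ R.Te v, ∀ x ∈ W, x ∉ R.Vf v f s := fun s hs x hx h =>
    (hWA hx).2 (Set.mem_biUnion hs h)
  refine ⟨f, hf.restrict hv hvy hyU, ?_⟩
  have hle := RTI.cap_le_succ_of_par_mem_Vf_of_notMem hv hvy hpX (hUT t ht _ hyW)
  have heven : Even (R.hval v W f) := by
    refine hf.1.even_hval hv ?_
    rintro s (rfl | hs) hsW
    · exact RTI.not_below_par hv (hvy.trans (hconn.below_top hyW hpy hsW))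
    · exact hUT s hs s hsW (RTI.self_mem_Vf hs.1)
  have hsat : ∀ x ∈ R.cutE v W, x ≠ y₀ → f x = R.c x := by
    rintro x ⟨hvx, hx⟩ hne
    refine le_antisymm (hf.2.1 x hvx) ?_
    by_cases hxW : x ∈ W
    · have hpx : R.par x ∉ W := fun h => hx (by simp [hxW, h])
      exact (hne ((hconn.below_top hxW hpx hyW).antisymm (hconn.below_top hyW hpy hxW))).elim
    · have hpx : R.par x ∈ W := by
        by_contra h
        exact hx (by simp [hxW, h])
      have hxU : x ∈ R.UT v f := by
        by_contra h
        exact hxW (hdown x hvx hpx ⟨Or.inr hvx, h⟩)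
      simp only [RTI.UT, Set.mem_iUnion] at hxU
      obtain ⟨s, hs, hxs⟩ := hxU
      exact RTI.cap_le_of_mem_Vf_of_par_notMem hv hvx hxs (hUT s hs _ hpx)
  have hycut : y₀ ∈ R.cutE v W := ⟨hvy, by simp [hyW, hpy]⟩
  rw [RTI.hval, RTI.finsum_mem_eq_sum_ite, ← Finset.add_sum_erase _ _ (Finset.mem_univ y₀),
    if_pos hycut] at heven hodd
  have hrest : ∑ x ∈ Finset.univ.erase y₀, (if x ∈ R.cutE v W then f x else 0) =
      ∑ x ∈ Finset.univ.erase y₀, if x ∈ R.cutE v W then R.c x else 0 := by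
    refine Finset.sum_congr rfl fun x hx => ?_
    split_ifs with h
    · exact hsat x h (Finset.ne_of_mem_erase hx)
    · rfl
  rw [hrest] at heven
  have hfy := hf.2.1 y₀ hvy
  obtain ⟨m, hm⟩ := heven
  obtain ⟨n, hn⟩ := hodd
  omega
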